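/- arXiv:1806.09821 — 3 statements merged into one kernel-verified Lean document; each statement's English description precedes it below -/
import Mathlib

section
/- Let n ≥ 1, let Ω ⊆ ℝⁿ be a bounded measurable set, and let s : ℝⁿ → ℝⁿ be a continuously differentiable vector field whose derivative is bounded (so s is Lipschitz). For t ∈ ℝ let Φ_t = id + t·s denote the perturbed identity map. Then the function t ↦ vol(Φ_t(Ω)) (the Lebesgue measure of the image of Ω under Φ_t) is differentiable at t = 0, and its derivative equals ∫_Ω div s(x) dx, where div s = trace of the Fréchet derivative of s. (This is the Hadamard volume derivative formula used throughout the paper to compute shape sensitivities of volume-type functionals.) -/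
open MeasureTheory

namespace ContinuousLinearMap

variable {V : Type*} [NormedAddCommGroup V] [NormedSpace ℝ V] [FiniteDimensional ℝ V]

theorem contDiff_det : ContDiff ℝ 1 (fun A : V →L[ℝ] V => A.det) := by
  classical
  let b := Module.finBasis ℝ V
  have hentry : ∀ i j, ContDiff ℝ 1
      (fun A : V →L[ℝ] V => LinearMap.toMatrix b b A.toLinearMap i j) := by
    intro i j
    simp only [LinearMap.toMatrix_apply]
    exact ((b.coord i).toContinuousLinearMap.contDiff).comp
      (contDiff_id.clm_apply contDiff_const)
  have hdet : (fun A : V →L[ℝ] V => A.det) =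
      fun A => (LinearMap.toMatrix b b A.toLinearMap).det := by
    ext A
    rw [LinearMap.det_toMatrix, ContinuousLinearMap.det]
  simp only [hdet, Matrix.det_apply]
  exact ContDiff.sum fun σ _ => (contDiff_prod fun i _ => hentry _ _).const_smul _

theorem hasDerivAt_det_one_add_smul (A : V →L[ℝ] V) :
    HasDerivAt (fun t : ℝ => (1 + t • A).det) (LinearMap.trace ℝ V A.toLinearMap) 0 := by
  classical
  let b := Module.finBasis ℝ V
  let M := LinearMap.toMatrix b b A.toLinearMap
  let p := (Matrix.det (1 + (Polynomial.X : Polynomial ℝ) • M.map Polynomial.C)).divX.divX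
  have hdet : (fun t : ℝ => (1 + t • A).det) =
      fun t => 1 + M.trace * t + p.eval t * t ^ 2 := by
    ext t
    rw [← Matrix.det_one_add_smul, ContinuousLinearMap.det, ← LinearMap.det_toMatrix b]
    congr 1
    simp [M, LinearMap.toMatrix_one]
  rw [hdet, LinearMap.trace_eq_matrix_trace ℝ b]
  convert! (((hasDerivAt_id (0 : ℝ)).const_mul M.trace).const_add 1).add
    ((p.hasDerivAt 0).mul (hasDerivAt_pow 2 (0 : ℝ))) using 1
  simp [M]

theorem hasDerivAt_abs_det_one_add_smul (A : V →L[ℝ] V) :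
    HasDerivAt (fun t : ℝ => |(1 + t • A).det|) (LinearMap.trace ℝ V A.toLinearMap) 0 := by
  have h := hasDerivAt_det_one_add_smul A
  refine h.congr_of_eventuallyEq ?_
  have hpos : (0 : ℝ) < (1 + (0 : ℝ) • A).det := by
    simp [ContinuousLinearMap.det]
  filter_upwards [h.continuousAt.eventually (lt_mem_nhds hpos)] with t ht
  exact abs_of_pos ht

theorem exists_lipschitzOnWith_abs_det_one_add_smul (C : ℝ) :
    ∃ K : NNReal, ∀ A : V →L[ℝ] V, ‖A‖ ≤ C →
      LipschitzOnWith K (fun t : ℝ => |(1 + t • A).det|) (Metric.ball 0 1) := by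
  obtain ⟨K, hK⟩ := (contDiff_det (V := V)).contDiffOn.exists_lipschitzOnWith one_ne_zero
    (convex_closedBall 1 C) (isCompact_closedBall 1 C)
  refine ⟨K * C.toNNReal, fun A hA => LipschitzOnWith.of_dist_le_mul fun t ht u hu => ?_⟩
  have hC : 0 ≤ C := (norm_nonneg A).trans hA
  have hmem : ∀ r ∈ Metric.ball (0 : ℝ) 1, 1 + r • A ∈ Metric.closedBall (1 : V →L[ℝ] V) C := by
    intro r hr
    rw [mem_ball_zero_iff] at hr
    rw [mem_closedBall_iff_norm, add_sub_cancel_left, norm_smul]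
    nlinarith [norm_nonneg A, norm_nonneg r]
  calc dist |(1 + t • A).det| |(1 + u • A).det|
      ≤ dist (1 + t • A).det (1 + u • A).det := abs_abs_sub_abs_le_abs_sub _ _
    _ ≤ K * dist (1 + t • A) (1 + u • A) := hK.dist_le_mul _ (hmem t ht) _ (hmem u hu)
    _ = K * (dist t u * ‖A‖) := by
      rw [dist_add_left, dist_eq_norm, ← sub_smul, norm_smul, dist_eq_norm]
    _ ≤ K * (dist t u * C) := by gcongr
    _ = ↑(K * C.toNNReal) * dist t u := by
      rw [NNReal.coe_mul, Real.coe_toNNReal C hC]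
      ring

end ContinuousLinearMap

theorem LipschitzWith.injective_id_add_smul {V : Type*} [NormedAddCommGroup V] [NormedSpace ℝ V]
    {s : V → V} {K : NNReal} (hs : LipschitzWith K s) {t : ℝ} (ht : |t| * K < 1) :
    Function.Injective fun x => x + t • s x := by
  intro x y hxy
  have hsub : x - y = t • (s y - s x) := by
    rw [smul_sub, sub_eq_sub_iff_add_eq_add]
    exact hxy.trans (add_comm _ _)
  have hle : ‖x - y‖ ≤ |t| * K * ‖x - y‖ := by
    calc ‖x - y‖ = |t| * ‖s y - s x‖ := by rw [hsub, norm_smul, Real.norm_eq_abs]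
      _ ≤ |t| * (K * ‖y - x‖) := by gcongr; exact hs.norm_sub_le y x
      _ = |t| * K * ‖x - y‖ := by rw [norm_sub_rev y x, mul_assoc]
  rw [← sub_eq_zero, ← norm_eq_zero]
  nlinarith [norm_nonneg (x - y)]

theorem toReal_addHaar_image_eq_integral_abs_det {V : Type*} [NormedAddCommGroup V]
    [NormedSpace ℝ V] [FiniteDimensional ℝ V] [MeasurableSpace V] [BorelSpace V]
    (μ : Measure V) [μ.IsAddHaarMeasure] {Ω : Set V} (hΩ : MeasurableSet Ω) {f : V → V}
    {f' : V → V →L[ℝ] V} (hf' : ∀ x ∈ Ω, HasFDerivWithinAt f (f' x) Ω x)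
    (hf : Set.InjOn f Ω) : (μ (f '' Ω)).toReal = ∫ x in Ω, |(f' x).det| ∂μ := by
  simpa [Measure.real] using integral_image_eq_integral_abs_det_fderiv_smul μ hΩ hf' hf
    (fun _ => (1 : ℝ))

/-- **Hadamard volume derivative formula.**
For a bounded measurable set `Ω ⊆ ℝⁿ` and a `C¹` vector field `s` with bounded derivative,
the map `t ↦ vol((id + t • s) '' Ω)` is differentiable at `t = 0` with derivative
`∫_Ω div s(x) dx`, where `div s(x) = trace (Ds(x))`. -/
theorem hadamard_volume_derivative
    (n : ℕ) (hn : 1 ≤ n) (Ω : Set (EuclideanSpace ℝ (Fin n)))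
    (hΩb : Bornology.IsBounded Ω) (hΩm : MeasurableSet Ω)
    (s : EuclideanSpace ℝ (Fin n) → EuclideanSpace ℝ (Fin n))
    (hs : ContDiff ℝ 1 s) (C : ℝ) (hC : ∀ x, ‖fderiv ℝ s x‖ ≤ C) :
    HasDerivAt (fun t : ℝ => (volume ((fun x => x + t • s x) '' Ω)).toReal)
      (∫ x in Ω,
        LinearMap.trace ℝ (EuclideanSpace ℝ (Fin n)) (fderiv ℝ s x).toLinearMap) 0 := by
  obtain ⟨K, hK⟩ := ContinuousLinearMap.exists_lipschitzOnWith_abs_det_one_add_smul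
    (V := EuclideanSpace ℝ (Fin n)) C
  have hC0 : 0 ≤ C := (norm_nonneg _).trans (hC 0)
  have hfin : volume Ω < ⊤ := hΩb.measure_lt_top
  have : IsFiniteMeasure (volume.restrict Ω) := ⟨by simpa using hfin⟩
  have hsd : Differentiable ℝ s := hs.differentiable one_ne_zero
  have hDs : Continuous (fderiv ℝ s) := hs.continuous_fderiv one_ne_zero
  have hlip : LipschitzWith C.toNNReal s :=
    lipschitzWith_of_nnnorm_fderiv_le hsd fun x => by
      rw [← NNReal.coe_le_coe, Real.coe_toNNReal C hC0]
      exact hC x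
  have hdet : ∀ t : ℝ, Continuous fun x => |(1 + t • fderiv ℝ s x).det| := fun t =>
    (ContinuousLinearMap.continuous_det.comp (continuous_const.add (hDs.const_smul t))).abs
  have htrace : Continuous fun x =>
      LinearMap.trace ℝ (EuclideanSpace ℝ (Fin n)) (fderiv ℝ s x).toLinearMap :=
    ((LinearMap.trace ℝ (EuclideanSpace ℝ (Fin n))).comp
      (ContinuousLinearMap.coeLM ℝ)).continuous_of_finiteDimensional.comp hDs
  have hderiv := (hasDerivAt_integral_of_dominated_loc_of_lip (μ := volume.restrict Ω)
    (F := fun t x => |(1 + t • fderiv ℝ s x).det|) (bound := fun _ => (K : ℝ))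
    (Metric.ball_mem_nhds (0 : ℝ) one_pos)
    (.of_forall fun t => (hdet t).aestronglyMeasurable)
    (by simp [ContinuousLinearMap.det])
    htrace.aestronglyMeasurable
    (.of_forall fun x => by simpa using hK _ (hC x))
    (integrable_const _)
    (.of_forall fun x => ContinuousLinearMap.hasDerivAt_abs_det_one_add_smul _)).2
  refine hderiv.congr_of_eventuallyEq ?_
  have hsmall : ∀ᶠ t : ℝ in nhds 0, |t| * C.toNNReal < 1 := by
    have hcont : Continuous fun t : ℝ => |t| * C.toNNReal := by fun_prop
    exact hcont.continuousAt.eventually (gt_mem_nhds (by simp))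
  filter_upwards [hsmall] with t ht
  exact toReal_addHaar_image_eq_integral_abs_det volume hΩm
    (fun x _ => ((hasFDerivAt_id x).add ((hsd x).hasFDerivAt.const_smul t)).hasFDerivWithinAt)
    (hlip.injective_id_add_smul ht).injOn
end

section
/- Let n ≥ 1, let Ω ⊆ ℝⁿ be a bounded measurable set, let s : ℝⁿ → ℝⁿ be a C¹ vector field with bounded derivative, and let Φ_t = id + t·s. Fix a coordinate index i. Then the first-moment function t ↦ ∫_{Φ_t(Ω)} x_i dx is differentiable at t = 0 with derivative ∫_Ω ( s_i(x) + x_i · div s(x) ) dx, where s_i denotes the i-th component of s; equivalently the derivative equals ∫_Ω div( x_i · s(x) ) dx. (This is the key intermediate derivative used to obtain the shape sensitivity of the centroid constraint in the Stokes example.) -/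
open MeasureTheory

open Filter Topology

/-- The determinant is a smooth function on the endomorphisms of a finite-dimensional space. -/
theorem ContinuousLinearMap.contDiff_det_s3 {E : Type*} [NormedAddCommGroup E] [NormedSpace ℝ E]
    [FiniteDimensional ℝ E] {m : WithTop ℕ∞} : ContDiff ℝ m (fun A : E →L[ℝ] E => A.det) := by
  let b := Module.finBasis ℝ E
  have h : (fun A : E →L[ℝ] E => A.det) = fun A => ∑ σ : Equiv.Perm (Fin (Module.finrank ℝ E)),
      (Equiv.Perm.sign σ : ℝ) * ∏ j, b.coord (σ j) (A (b j)) := by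
    ext A
    rw [ContinuousLinearMap.det, ← LinearMap.det_toMatrix b, Matrix.det_apply']
    simp [LinearMap.toMatrix_apply]
  rw [h]
  refine ContDiff.sum fun σ _ => contDiff_const.mul (contDiff_prod fun j _ => ?_)
  exact ((b.coord (σ j)).toContinuousLinearMap.comp
    (ContinuousLinearMap.apply ℝ E (b j))).contDiff

theorem ContinuousLinearMap.hasDerivAt_det_id_add_smul {E : Type*} [NormedAddCommGroup E]
    [NormedSpace ℝ E] [FiniteDimensional ℝ E] (A : E →L[ℝ] E) (t : ℝ) :
    HasDerivAt (fun t : ℝ => (ContinuousLinearMap.id ℝ E + t • A).det)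
      (fderiv ℝ (fun B : E →L[ℝ] E => B.det) (ContinuousLinearMap.id ℝ E + t • A) A) t := by
  have h₁ : HasFDerivAt (fun B : E →L[ℝ] E => B.det) _ (ContinuousLinearMap.id ℝ E + t • A) :=
    ((ContinuousLinearMap.contDiff_det_s3 (m := 1)).differentiable one_ne_zero _).hasFDerivAt
  have h₂ : HasDerivAt (fun t : ℝ => ContinuousLinearMap.id ℝ E + t • A) A t := by
    simpa using ((hasDerivAt_id t).smul_const A).const_add (ContinuousLinearMap.id ℝ E)
  exact h₁.comp_hasDerivAt t h₂

/-- **Jacobi's formula** at the identity. -/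
theorem ContinuousLinearMap.fderiv_det_id {E : Type*} [NormedAddCommGroup E]
    [NormedSpace ℝ E] [FiniteDimensional ℝ E] (A : E →L[ℝ] E) :
    fderiv ℝ (fun B : E →L[ℝ] E => B.det) (ContinuousLinearMap.id ℝ E) A =
      LinearMap.trace ℝ E A.toLinearMap := by
  have h := ContinuousLinearMap.hasDerivAt_det_id_add_smul A 0
  rw [zero_smul, add_zero] at h
  refine h.unique ?_
  let b := Module.finBasis ℝ E
  let M := LinearMap.toMatrix b b A.toLinearMap
  let p := (1 + (Polynomial.X : Polynomial ℝ) • M.map Polynomial.C).det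
  have hp : (fun t : ℝ => (ContinuousLinearMap.id ℝ E + t • A).det) = fun t => p.eval t := by
    ext t
    rw [ContinuousLinearMap.det, ← LinearMap.det_toMatrix b]
    simp [p, M, eval_det, ← Matrix.smul_eq_mul_diagonal]
  rw [hp, LinearMap.trace_eq_matrix_trace ℝ b, ← Matrix.derivative_det_one_add_X_smul]
  exact p.hasDerivAt 0

/-- Differentiation under the integral sign over a bounded set, for jointly continuous integrand
and derivative. -/
theorem hasDerivAt_setIntegral_of_isBounded {E : Type*} [NormedAddCommGroup E] [ProperSpace E]
    [MeasurableSpace E] [BorelSpace E] {μ : Measure E} [IsFiniteMeasureOnCompacts μ] {Ω : Set E}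
    (hΩb : Bornology.IsBounded Ω) (hΩm : MeasurableSet Ω) {F F' : ℝ → E → ℝ}
    (hF : Continuous (Function.uncurry F)) (hF' : Continuous (Function.uncurry F'))
    (h : ∀ t x, HasDerivAt (fun t => F t x) (F' t x) t) (t₀ : ℝ) :
    HasDerivAt (fun t => ∫ x in Ω, F t x ∂μ) (∫ x in Ω, F' t₀ x ∂μ) t₀ := by
  have hK : IsCompact (closure Ω) := hΩb.isCompact_closure
  have hfin : μ Ω < ⊤ := (measure_mono subset_closure).trans_lt hK.measure_lt_top
  obtain ⟨B, hB⟩ := ((isCompact_closedBall t₀ 1).prod hK).exists_bound_of_continuousOn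
    hF'.continuousOn
  refine (hasDerivAt_integral_of_dominated_loc_of_deriv_le (bound := fun _ => B)
    (Metric.closedBall_mem_nhds t₀ one_pos) ?_ ?_ ?_ ?_ ?_ ?_).2
  · exact .of_forall fun t => (hF.comp (Continuous.prodMk_right t)).aestronglyMeasurable
  · exact ((hF.comp (Continuous.prodMk_right t₀)).continuousOn.integrableOn_compact hK).mono_set
      subset_closure
  · exact (hF'.comp (Continuous.prodMk_right t₀)).aestronglyMeasurable
  · exact (ae_restrict_iff' hΩm).2 <| .of_forall fun x hx t ht =>
      hB (t, x) ⟨ht, subset_closure hx⟩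
  · exact integrableOn_const hfin.ne
  · exact .of_forall fun x t _ => h t x

/-- A perturbation `id + t • s` of the identity by a Lipschitz field is injective for small `t`. -/
theorem LipschitzWith.eventually_injective_add_smul {E : Type*} [NormedAddCommGroup E]
    [NormedSpace ℝ E] {s : E → E} {K : NNReal} (hs : LipschitzWith K s) :
    ∀ᶠ t : ℝ in 𝓝 0, Function.Injective (fun x => x + t • s x) := by
  have hsmall : ∀ᶠ t : ℝ in 𝓝 0, |t| * K < 1 := by
    have hc : Continuous fun t : ℝ => |t| * K := by fun_prop
    exact hc.continuousAt.eventually_lt continuousAt_const (by simp)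
  filter_upwards [hsmall] with t ht x y hxy
  have heq : x - y = t • (s y - s x) := by
    rw [smul_sub, sub_eq_sub_iff_add_eq_add]
    simpa [add_comm] using hxy
  have hle : ‖x - y‖ ≤ |t| * K * ‖x - y‖ := by
    calc ‖x - y‖ = |t| * ‖s y - s x‖ := by
          conv_lhs => rw [heq, norm_smul, Real.norm_eq_abs]
      _ ≤ |t| * (K * ‖x - y‖) := by
          rw [norm_sub_rev x y]
          exact mul_le_mul_of_nonneg_left (hs.norm_sub_le y x) (abs_nonneg t)
      _ = |t| * K * ‖x - y‖ := by ring
  rw [← sub_eq_zero, ← norm_eq_zero]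
  nlinarith [norm_nonneg (x - y)]

theorem LinearMap.trace_smulRight_eq {E : Type*} [AddCommGroup E] [Module ℝ E]
    [FiniteDimensional ℝ E] (f : E →ₗ[ℝ] ℝ) (v : E) :
    LinearMap.trace ℝ E (f.smulRight v) = f v := by
  have h : f.smulRight v = dualTensorHom ℝ E E (f ⊗ₜ[ℝ] v) := by
    ext x
    simp
  rw [h, LinearMap.trace_eq_contract_apply, contractLeft_apply]

/-- The product rule `div (f s) = ⟨∇f, s⟩ + f div s`. -/
theorem trace_fderiv_smul {E : Type*} [NormedAddCommGroup E] [NormedSpace ℝ E]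
    [FiniteDimensional ℝ E] {f : E → ℝ} {s : E → E} {x : E} (hf : DifferentiableAt ℝ f x)
    (hs : DifferentiableAt ℝ s x) :
    LinearMap.trace ℝ E (fderiv ℝ (fun y => f y • s y) x).toLinearMap =
      fderiv ℝ f x (s x) + f x * LinearMap.trace ℝ E (fderiv ℝ s x).toLinearMap := by
  rw [fderiv_fun_smul hf hs, ContinuousLinearMap.toLinearMap_add, map_add, add_comm,
    ContinuousLinearMap.toLinearMap_smul, map_smul, smul_eq_mul]
  congr 1
  exact LinearMap.trace_smulRight_eq (fderiv ℝ f x).toLinearMap (s x)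

/-- **Shape derivative of the first moment.**
For bounded measurable `Ω ⊆ ℝⁿ`, a `C¹` vector field `s` with bounded derivative,
`Φ_t = id + t • s` and a coordinate index `i`, the map `t ↦ ∫_{Φ_t(Ω)} x_i dx` is
differentiable at `t = 0` with derivative `∫_Ω (s_i(x) + x_i · div s(x)) dx`, which
moreover equals `∫_Ω div (x_i · s(x)) dx`. -/
theorem first_moment_shape_derivative
    (n : ℕ) (hn : 1 ≤ n) (Ω : Set (EuclideanSpace ℝ (Fin n)))
    (hΩb : Bornology.IsBounded Ω) (hΩm : MeasurableSet Ω)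
    (s : EuclideanSpace ℝ (Fin n) → EuclideanSpace ℝ (Fin n))
    (hs : ContDiff ℝ 1 s) (C : ℝ) (hC : ∀ x, ‖fderiv ℝ s x‖ ≤ C)
    (i : Fin n) :
    HasDerivAt (fun t : ℝ => ∫ x in ((fun x => x + t • s x) '' Ω), x i)
      (∫ x in Ω,
        (s x i + x i *
          LinearMap.trace ℝ (EuclideanSpace ℝ (Fin n)) (fderiv ℝ s x).toLinearMap)) 0 ∧
    (∫ x in Ω,
        (s x i + x i *
          LinearMap.trace ℝ (EuclideanSpace ℝ (Fin n)) (fderiv ℝ s x).toLinearMap)) =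
      ∫ x in Ω,
        LinearMap.trace ℝ (EuclideanSpace ℝ (Fin n))
          (fderiv ℝ (fun y => y i • s y) x).toLinearMap := by
  have hA : Continuous (fderiv ℝ s) := hs.continuous_fderiv one_ne_zero
  have hsd : Differentiable ℝ s := hs.differentiable one_ne_zero
  have hsc : Continuous s := hs.continuous
  constructor
  · let J : ℝ → EuclideanSpace ℝ (Fin n) → EuclideanSpace ℝ (Fin n) →L[ℝ]
        EuclideanSpace ℝ (Fin n) := fun t x =>
      ContinuousLinearMap.id ℝ (EuclideanSpace ℝ (Fin n)) + t • fderiv ℝ s x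
    let F : ℝ → EuclideanSpace ℝ (Fin n) → ℝ := fun t x => (J t x).det * (x i + t * s x i)
    let F' : ℝ → EuclideanSpace ℝ (Fin n) → ℝ := fun t x =>
      fderiv ℝ (fun B : _ →L[ℝ] _ => B.det) (J t x) (fderiv ℝ s x) * (x i + t * s x i) +
        (J t x).det * s x i
    have hJ : Continuous (Function.uncurry J) :=
      continuous_const.add (continuous_fst.smul (hA.comp continuous_snd))
    have hdet : Continuous fun p : ℝ × EuclideanSpace ℝ (Fin n) => (J p.1 p.2).det :=
      ContinuousLinearMap.continuous_det.comp hJ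
    have hddet : Continuous fun p : ℝ × EuclideanSpace ℝ (Fin n) =>
        fderiv ℝ (fun B : _ →L[ℝ] _ => B.det) (J p.1 p.2) (fderiv ℝ s p.2) :=
      ((ContinuousLinearMap.contDiff_det_s3 (m := 1)).continuous_fderiv one_ne_zero |>.comp hJ).clm_apply
        (hA.comp continuous_snd)
    have hcoord : Continuous fun p : ℝ × EuclideanSpace ℝ (Fin n) => p.2 i + p.1 * s p.2 i := by
      fun_prop
    have hF : Continuous (Function.uncurry F) := hdet.mul hcoord
    have hF' : Continuous (Function.uncurry F') :=
      (hddet.mul hcoord).add (hdet.mul (by fun_prop))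
    have hderiv : ∀ t x, HasDerivAt (fun t => F t x) (F' t x) t := fun t x => by
      have h : HasDerivAt (fun t : ℝ => x i + t * s x i) (s x i) t := by
        simpa using ((hasDerivAt_id t).mul_const (s x i)).const_add (x i)
      exact (ContinuousLinearMap.hasDerivAt_det_id_add_smul (fderiv ℝ s x) t).mul h
    have hmain := hasDerivAt_setIntegral_of_isBounded (μ := volume) hΩb hΩm hF hF' hderiv 0
    have hF'0 : ∀ x, F' 0 x = s x i + x i *
        LinearMap.trace ℝ (EuclideanSpace ℝ (Fin n)) (fderiv ℝ s x).toLinearMap := by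
      intro x
      have hJ0 : J 0 x = ContinuousLinearMap.id ℝ (EuclideanSpace ℝ (Fin n)) := by
        ext1 v
        simp [J]
      have hdet0 : (ContinuousLinearMap.id ℝ (EuclideanSpace ℝ (Fin n))).det = 1 :=
        LinearMap.det_id
      change fderiv ℝ _ (J 0 x) _ * _ + (J 0 x).det * _ = _
      rw [hJ0, ContinuousLinearMap.fderiv_det_id, hdet0]
      ring
    simp only [hF'0] at hmain
    refine hmain.congr_of_eventuallyEq ?_
    have hlip : LipschitzWith C.toNNReal s :=
      lipschitzWith_of_nnnorm_fderiv_le hsd fun x => NNReal.le_toNNReal_of_coe_le (hC x)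
    have hpos : ∀ᶠ t : ℝ in 𝓝 0, ∀ x ∈ closure Ω, 0 < (J t x).det :=
      hΩb.isCompact_closure.eventually_forall_of_forall_eventually fun x _ =>
        continuousAt_const.eventually_lt hdet.continuousAt (by simp [J, ContinuousLinearMap.det])
    filter_upwards [hlip.eventually_injective_add_smul, hpos] with t hinj ht
    have hΦ : ∀ x ∈ Ω, HasFDerivWithinAt (fun x => x + t • s x) (J t x) Ω x := fun x _ =>
      ((hasFDerivAt_id x).add ((hsd x).hasFDerivAt.const_smul t)).hasFDerivWithinAt
    rw [integral_image_eq_integral_abs_det_fderiv_smul volume hΩm hΦ hinj.injOn]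
    refine setIntegral_congr_fun hΩm fun x hx => ?_
    simp [F, abs_of_pos (ht x (subset_closure hx))]
  · congr 1 with x
    have hi := (EuclideanSpace.proj i : EuclideanSpace ℝ (Fin n) →L[ℝ] ℝ).hasFDerivAt (x := x)
    have hi' : HasFDerivAt (fun y : EuclideanSpace ℝ (Fin n) => y i) _ x := hi
    rw [trace_fderiv_smul hi'.differentiableAt (hsd x), hi'.fderiv]
    rfl
end

section
/- Let Ω ⊆ ℝⁿ (n ≥ 1) be a bounded measurable set with vol(Ω) < 1, let s : ℝⁿ → ℝⁿ be a C¹ vector field with bounded derivative, let Φ_t = id + t·s, and fix a coordinate index i. Define the obstacle-centroid coordinate of a fluid domain ω (a subset of the unit region of total volume 1) by C_i(ω) = (1/2 − ∫_ω x_i dx) / (1 − vol(ω)), and assume vol(Φ_t(Ω)) < 1 for all small t. Fix a target value C₀ ∈ ℝ and a penalty parameter γ₂ > 0, and set J_C(t) = γ₂ · (C_i(Φ_t(Ω)) − C₀)². Then J_C is differentiable at t = 0 with J_C′(0) = 2 γ₂ (C_i(Ω) − C₀) · (1 − vol(Ω))⁻¹ · ∫_Ω div( (C_i(Ω) − x_i)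 · s(x) ) dx. (This is the shape sensitivity of the centroid penalty term J_{Cx} (respectively J_{Cy}) in the Stokes drag-minimization example, obtained via the quotient rule and expressed in volume form via the divergence theorem.) -/
open MeasureTheory

/-- The `i`-th coordinate of the obstacle's centroid, when the fluid domain is `ω` inside a
region of total volume `1` whose first-moment integral in direction `i` equals `1/2`:
`C_i(ω) = (1/2 − ∫_ω x_i dx) / (1 − vol(ω))`. -/
noncomputable def obstacleCentroid (n : ℕ) (i : Fin n)
    (ω : Set (EuclideanSpace ℝ (Fin n))) : ℝ :=
  (1 / 2 - ∫ x in ω, x i) / (1 - (volume ω).toReal)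

section ShapeDerivative

open Topology Filter

variable {E : Type*} [NormedAddCommGroup E] [NormedSpace ℝ E]

theorem injective_id_add_smul {s : E → E} (hs : Differentiable ℝ s) {C : ℝ}
    (hC : ∀ x, ‖fderiv ℝ s x‖ ≤ C) {t : ℝ} (ht : |t| * C < 1) :
    Function.Injective (fun x => x + t • s x) := by
  intro x y hxy
  have hlip : ‖s y - s x‖ ≤ C * ‖y - x‖ :=
    convex_univ.norm_image_sub_le_of_norm_fderiv_le (fun z _ => hs z) (fun z _ => hC z)
      (Set.mem_univ x) (Set.mem_univ y)
  have heq : x - y = t • (s y - s x) := by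
    have : x + t • s x = y + t • s y := hxy
    rw [smul_sub, sub_eq_sub_iff_add_eq_add, this, add_comm]
  have hnorm : ‖x - y‖ ≤ |t| * C * ‖x - y‖ := by
    calc ‖x - y‖ = |t| * ‖s y - s x‖ := by rw [heq, norm_smul, Real.norm_eq_abs]
      _ ≤ |t| * (C * ‖y - x‖) := by gcongr
      _ = |t| * C * ‖x - y‖ := by rw [norm_sub_rev y x, mul_assoc]
  have : ‖x - y‖ = 0 := by nlinarith [norm_nonneg (x - y)]
  exact sub_eq_zero.mp (norm_eq_zero.mp this)

variable [FiniteDimensional ℝ E]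

theorem contDiff_continuousLinearMap_det {k : WithTop ℕ∞} :
    ContDiff ℝ k (fun B : E →L[ℝ] E => B.det) := by
  classical
  let b := Module.finBasis ℝ E
  have hdet : (fun B : E →L[ℝ] E => B.det) = fun B : E →L[ℝ] E =>
      ∑ σ : Equiv.Perm (Fin (Module.finrank ℝ E)), (Equiv.Perm.sign σ : ℤ) •
        ∏ j, LinearMap.toMatrix b b (B : E →ₗ[ℝ] E) (σ j) j := by
    funext B
    rw [ContinuousLinearMap.det, ← LinearMap.det_toMatrix b, Matrix.det_apply]
    rfl
  have hentry (j l) :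
      ContDiff ℝ k (fun B : E →L[ℝ] E => LinearMap.toMatrix b b (B : E →ₗ[ℝ] E) j l) := by
    simp only [LinearMap.toMatrix_apply]
    exact (LinearMap.toContinuousLinearMap (b.coord j)).contDiff.comp
      (contDiff_id.clm_apply contDiff_const)
  rw [hdet]
  refine ContDiff.sum fun σ _ => ?_
  simp only [zsmul_eq_mul]
  exact contDiff_const.mul (contDiff_prod fun j _ => hentry _ _)

theorem hasDerivAt_det_one_add_smul (B : E →L[ℝ] E) :
    HasDerivAt (fun t : ℝ => (1 + t • B).det) (LinearMap.trace ℝ E B.toLinearMap) 0 := by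
  classical
  let b := Module.finBasis ℝ E
  set M := LinearMap.toMatrix b b (B : E →ₗ[ℝ] E)
  have hdet : (fun t : ℝ => (1 + t • B).det) = fun t => 1 + M.trace * t +
      (Matrix.det (1 + (Polynomial.X : Polynomial ℝ) •
        M.map Polynomial.C)).divX.divX.eval t * t ^ 2 := by
    funext t
    rw [← Matrix.det_one_add_smul, ContinuousLinearMap.det, ← LinearMap.det_toMatrix b]
    congr 1
    simp [M, LinearMap.toMatrix_one]
  rw [hdet, LinearMap.trace_eq_matrix_trace ℝ b]
  have h := (((hasDerivAt_id (0 : ℝ)).const_mul M.trace).const_add 1).add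
    ((Polynomial.hasDerivAt (Matrix.det (1 + (Polynomial.X : Polynomial ℝ) •
        M.map Polynomial.C)).divX.divX (0 : ℝ)).mul (hasDerivAt_pow 2 (0 : ℝ)))
  refine h.congr_deriv ?_
  simp [M]

theorem hasDerivAt_abs_det_mul_comp {g : E → ℝ} (hg : Differentiable ℝ g) (x v : E)
    (B : E →L[ℝ] E) :
    HasDerivAt (fun t : ℝ => |(1 + t • B).det| * g (x + t • v))
      (fderiv ℝ g x v + g x * LinearMap.trace ℝ E B.toLinearMap) 0 := by
  have hdet0 : (1 + (0 : ℝ) • B).det = 1 := by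
    rw [zero_smul, add_zero]
    exact map_one (LinearMap.det (M := E) (A := ℝ))
  have hdet := hasDerivAt_det_one_add_smul B
  have habs : (fun t : ℝ => |(1 + t • B).det|) =ᶠ[𝓝 0] fun t => (1 + t • B).det := by
    have hpos : ∀ᶠ t in 𝓝 (0 : ℝ), 0 < (1 + t • B).det :=
      hdet.continuousAt.eventually (lt_mem_nhds (one_pos.trans_eq hdet0.symm))
    filter_upwards [hpos] with t ht using abs_of_pos ht
  have hpath : HasDerivAt (fun t : ℝ => x + t • v) v 0 := by
    simpa using ((hasDerivAt_id (0 : ℝ)).smul_const v).const_add x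
  have hcomp : HasDerivAt (fun t : ℝ => g (x + t • v)) (fderiv ℝ g x v) 0 := by
    have hgx : HasFDerivAt g (fderiv ℝ g x) (x + (0 : ℝ) • v) := by
      simpa using (hg x).hasFDerivAt
    exact hgx.comp_hasDerivAt 0 hpath
  refine ((hdet.congr_of_eventuallyEq habs).mul hcomp).congr_deriv ?_
  rw [hdet0, abs_one, zero_smul, add_zero]
  ring

theorem locallyLipschitz_abs_det_mul_comp {g : E → ℝ} (hg : ContDiff ℝ 1 g) :
    LocallyLipschitz (fun p : ℝ × E × E × (E →L[ℝ] E) =>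
      |(1 + p.1 • p.2.2.2).det| * g (p.2.1 + p.1 • p.2.2.1)) := by
  have hdet : ContDiff ℝ 1 (fun p : ℝ × E × E × (E →L[ℝ] E) => (1 + p.1 • p.2.2.2).det) :=
    contDiff_continuousLinearMap_det.comp (by fun_prop)
  have hcomp : ContDiff ℝ 1
      (fun p : ℝ × E × E × (E →L[ℝ] E) => g (p.2.1 + p.1 • p.2.2.1)) :=
    hg.comp (by fun_prop)
  have habs : LocallyLipschitz (fun r : ℝ => |r|) := lipschitzWith_one_norm.locallyLipschitz
  have hmul : LocallyLipschitz (fun q : ℝ × ℝ => q.1 * q.2) :=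
    (contDiff_mul (𝕜 := ℝ) (n := 1)).locallyLipschitz
  exact hmul.comp ((habs.comp hdet.locallyLipschitz).prodMk hcomp.locallyLipschitz)

variable [MeasurableSpace E] [BorelSpace E] (μ : Measure E) [μ.IsAddHaarMeasure]

/-- Shape derivative of `ω ↦ ∫_ω g` along the flow `id + t • s`. -/
theorem integrableOn_and_hasDerivAt_integral_image_id_add_smul {Ω : Set E}
    (hΩb : Bornology.IsBounded Ω) (hΩm : MeasurableSet Ω) {s : E → E} (hs : ContDiff ℝ 1 s)
    {C : ℝ} (hC : ∀ x, ‖fderiv ℝ s x‖ ≤ C) {g : E → ℝ} (hg : ContDiff ℝ 1 g) :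
    IntegrableOn (fun x => fderiv ℝ g x (s x) +
        g x * LinearMap.trace ℝ E (fderiv ℝ s x).toLinearMap) Ω μ ∧
      HasDerivAt (fun t : ℝ => ∫ x in (fun x => x + t • s x) '' Ω, g x ∂μ)
        (∫ x in Ω, (fderiv ℝ g x (s x) +
          g x * LinearMap.trace ℝ E (fderiv ℝ s x).toLinearMap) ∂μ) 0 := by
  have hsd : Differentiable ℝ s := hs.differentiable one_ne_zero
  have hsf : Continuous (fderiv ℝ s) := hs.continuous_fderiv one_ne_zero
  have hgf : Continuous (fderiv ℝ g) := hg.continuous_fderiv one_ne_zero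
  have hΩc : IsCompact (closure Ω) := hΩb.isCompact_closure
  have hint {f : E → ℝ} (hf : Continuous f) : IntegrableOn f Ω μ :=
    hf.continuousOn.integrableOn_of_subset_isCompact hΩc hΩm subset_closure
      hΩb.measure_lt_top.ne
  let F : ℝ → E → ℝ := fun t x => |(1 + t • fderiv ℝ s x).det| * g (x + t • s x)
  have hF (t : ℝ) : Continuous (F t) := by
    refine Continuous.mul (Continuous.abs (ContinuousLinearMap.continuous_det.comp ?_))
      (hg.continuous.comp ?_)
    · fun_prop
    · exact continuous_id.add (hs.continuous.const_smul t)
  have htrace : Continuous fun x => LinearMap.trace ℝ E (fderiv ℝ s x).toLinearMap := by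
    let T : (E →L[ℝ] E) →ₗ[ℝ] ℝ := LinearMap.trace ℝ E ∘ₗ ContinuousLinearMap.coeLM ℝ
    exact T.continuous_of_finiteDimensional.comp hsf
  have hF' : Continuous fun x => fderiv ℝ g x (s x) +
      g x * LinearMap.trace ℝ E (fderiv ℝ s x).toLinearMap :=
    (hgf.clm_apply hs.continuous).add (hg.continuous.mul htrace)
  let P : E → E × E × (E →L[ℝ] E) := fun x => (x, s x, fderiv ℝ s x)
  have hP : Continuous P := continuous_id.prodMk (hs.continuous.prodMk hsf)
  obtain ⟨K, hK⟩ := ((locallyLipschitz_abs_det_mul_comp hg).locallyLipschitzOn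
    (s := Metric.closedBall (0 : ℝ) 1 ×ˢ (P '' closure Ω))).exists_lipschitzOnWith_of_compact
      ((isCompact_closedBall (0 : ℝ) 1).prod (hΩc.image hP))
  have hlip (x : E) (hx : x ∈ Ω) :
      LipschitzOnWith (Real.nnabs K) (F · x) (Metric.closedBall (0 : ℝ) 1) := by
    have h := hK.comp ((LipschitzWith.prodMk_right (P x)).lipschitzOnWith
      (s := Metric.closedBall (0 : ℝ) 1))
      (fun t ht => ⟨ht, Set.mem_image_of_mem P (subset_closure hx)⟩)
    rw [mul_one] at h
    rwa [Real.nnabs_of_nonneg K.coe_nonneg, Real.toNNReal_coe]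
  have hker := hasDerivAt_integral_of_dominated_loc_of_lip (𝕜 := ℝ) (μ := μ.restrict Ω)
    (F := F) (x₀ := 0) (bound := fun _ => (K : ℝ))
    (Metric.closedBall_mem_nhds (0 : ℝ) one_pos)
    (Eventually.of_forall fun t => (hF t).aestronglyMeasurable) (hint (hF 0))
    hF'.aestronglyMeasurable
    ((ae_restrict_mem hΩm).mono hlip) (hint continuous_const)
    (Eventually.of_forall fun x => hasDerivAt_abs_det_mul_comp (hg.differentiable one_ne_zero)
      x (s x) (fderiv ℝ s x))
  refine ⟨hker.1, hker.2.congr_of_eventuallyEq ?_⟩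
  have hsmall : ∀ᶠ t in 𝓝 (0 : ℝ), |t| * C < 1 := by
    have hcont : ContinuousAt (fun t : ℝ => |t| * C) 0 := by fun_prop
    exact hcont.eventually (gt_mem_nhds (by simp))
  filter_upwards [hsmall] with t ht
  refine integral_image_eq_integral_abs_det_fderiv_smul μ hΩm
    (f' := fun x => 1 + t • fderiv ℝ s x) (fun x _ => ?_)
    (injective_id_add_smul hsd hC ht).injOn g
  exact ((hasFDerivAt_id x).add ((hsd x).hasFDerivAt.const_smul t)).hasFDerivWithinAt

end ShapeDerivative

theorem trace_fderiv_const_sub_coord_smul {n : ℕ}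
    {s : EuclideanSpace ℝ (Fin n) → EuclideanSpace ℝ (Fin n)} (hs : Differentiable ℝ s)
    (c : ℝ) (i : Fin n) (x : EuclideanSpace ℝ (Fin n)) :
    LinearMap.trace ℝ (EuclideanSpace ℝ (Fin n))
        (fderiv ℝ (fun y => (c - y i) • s y) x).toLinearMap =
      c * LinearMap.trace ℝ (EuclideanSpace ℝ (Fin n)) (fderiv ℝ s x).toLinearMap -
        (s x i + x i *
          LinearMap.trace ℝ (EuclideanSpace ℝ (Fin n)) (fderiv ℝ s x).toLinearMap) := by
  have hcoord : HasFDerivAt (fun y : EuclideanSpace ℝ (Fin n) => c - y i)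
      (-EuclideanSpace.proj (𝕜 := ℝ) i) x :=
    (EuclideanSpace.proj (𝕜 := ℝ) i).hasFDerivAt.const_sub c
  have hsmul := (hcoord.smul (hs x).hasFDerivAt).fderiv
  simp only [Pi.smul_def'] at hsmul
  rw [hsmul]
  have hrank : (((-EuclideanSpace.proj (𝕜 := ℝ) i :
      EuclideanSpace ℝ (Fin n) →L[ℝ] ℝ).smulRight (s x)).toLinearMap) =
      LinearMap.smulRight (-(EuclideanSpace.proj (𝕜 := ℝ) i :
        EuclideanSpace ℝ (Fin n) →L[ℝ] ℝ).toLinearMap) (s x) := rfl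
  simp only [ContinuousLinearMap.toLinearMap_add, ContinuousLinearMap.toLinearMap_smul,
    map_add, map_smul, hrank, LinearMap.trace_smulRight, smul_eq_mul]
  simp
  ring

/-- **Shape sensitivity of the centroid penalty.**
For bounded measurable `Ω ⊆ ℝⁿ` with `vol(Ω) < 1`, a `C¹` vector field `s` with bounded
derivative such that `vol(Φ_t(Ω)) < 1` for all small `t` (where `Φ_t = id + t • s`),
a target value `C₀` and a penalty parameter `γ₂ > 0`, the functional
`J_C(t) = γ₂ (C_i(Φ_t(Ω)) − C₀)²` is differentiable at `t = 0` with derivative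
`2 γ₂ (C_i(Ω) − C₀) (1 − vol(Ω))⁻¹ ∫_Ω div ((C_i(Ω) − x_i) • s(x)) dx`. -/
theorem centroid_penalty_shape_derivative
    (n : ℕ) (hn : 1 ≤ n) (Ω : Set (EuclideanSpace ℝ (Fin n)))
    (hΩb : Bornology.IsBounded Ω) (hΩm : MeasurableSet Ω)
    (hΩvol : volume Ω < 1)
    (s : EuclideanSpace ℝ (Fin n) → EuclideanSpace ℝ (Fin n))
    (hs : ContDiff ℝ 1 s) (C : ℝ) (hC : ∀ x, ‖fderiv ℝ s x‖ ≤ C)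
    (i : Fin n)
    (hsmall : ∃ δ > (0 : ℝ), ∀ t : ℝ, |t| < δ →
      volume ((fun x => x + t • s x) '' Ω) < 1)
    (C₀ : ℝ) (γ₂ : ℝ) (hγ₂ : 0 < γ₂) :
    HasDerivAt
      (fun t : ℝ =>
        γ₂ * (obstacleCentroid n i ((fun x => x + t • s x) '' Ω) - C₀) ^ 2)
      (2 * γ₂ * (obstacleCentroid n i Ω - C₀) * (1 - (volume Ω).toReal)⁻¹ *
        ∫ x in Ω,
          LinearMap.trace ℝ (EuclideanSpace ℝ (Fin n))
            (fderiv ℝ (fun y => (obstacleCentroid n i Ω - y i) • s y) x).toLinearMap) 0 := by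
  set c := obstacleCentroid n i Ω with hc
  have hD : 1 - (volume Ω).toReal ≠ 0 := by
    have := (ENNReal.toReal_lt_toReal hΩvol.ne_top ENNReal.one_ne_top).2 hΩvol
    rw [ENNReal.toReal_one] at this
    linarith
  obtain ⟨hVint, hV⟩ := integrableOn_and_hasDerivAt_integral_image_id_add_smul volume hΩb hΩm
    hs hC (contDiff_const (c := (1 : ℝ)))
  obtain ⟨hIint, hI⟩ := integrableOn_and_hasDerivAt_integral_image_id_add_smul volume hΩb hΩm
    hs hC (EuclideanSpace.proj (𝕜 := ℝ) i).contDiff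
  simp only [fderiv_fun_const, Pi.zero_apply, zero_apply, zero_add, one_mul,
    setIntegral_const, smul_eq_mul, mul_one, Measure.real] at hV hVint
  simp only [ContinuousLinearMap.fderiv, PiLp.proj_apply] at hI hIint
  have himage : (fun x => x + (0 : ℝ) • s x) '' Ω = Ω := by simp
  have hquot := (hI.const_sub (1 / 2)).div (hV.const_sub 1) (by simpa only [himage] using hD)
  have hJ := ((hquot.sub_const C₀).pow 2).const_mul γ₂
  refine HasDerivAt.congr_deriv hJ ?_
  have hsplit : ∫ x in Ω, LinearMap.trace ℝ (EuclideanSpace ℝ (Fin n))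
      (fderiv ℝ (fun y => (c - y i) • s y) x).toLinearMap =
      c * (∫ x in Ω, LinearMap.trace ℝ (EuclideanSpace ℝ (Fin n)) (fderiv ℝ s x).toLinearMap) -
        ∫ x in Ω, (s x i + x i *
          LinearMap.trace ℝ (EuclideanSpace ℝ (Fin n)) (fderiv ℝ s x).toLinearMap) := by
    simp only [trace_fderiv_const_sub_coord_smul (hs.differentiable one_ne_zero)]
    rw [integral_sub (hVint.const_mul c) hIint, integral_const_mul]
  have hN : 1 / 2 - ∫ x in Ω, x i = c * (1 - (volume Ω).toReal) := by
    rw [hc, obstacleCentroid, div_mul_cancel₀ _ hD]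
  simp only [Pi.div_apply, himage, hsplit, hN]
  field_simp
  ring
end
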